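/- For any 𝐦, 𝐦' ∈ ℤ_{≥0}^{n−1} and any M, M' ∈ ℤ_{≥0}, the Minkowski sum of polytopes satisfies X_{𝐦,M} + X_{𝐦',M'} = X_{𝐦+𝐦', M+M'}, where the Minkowski sum of two subsets A, B of ℝ^{P} is {a + b : a ∈ A, b ∈ B}. -/

import Mathlib

open scoped Pointwise

/-- The poset `P` of pairs `(i,j)` with `1 ≤ j < i ≤ n` (componentwise order). -/
def posetP (n : ℕ) : Finset (ℕ × ℕ) :=
  (Finset.range (n + 1) ×ˢ Finset.range (n + 1)).filter
    (fun p => 1 ≤ p.2 ∧ p.2 < p.1 ∧ p.1 ≤ n)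

/-- The subposet `P_d = {(i,j) ∈ P : i > d ≥ j}`. -/
def posetPd (n d : ℕ) : Finset (ℕ × ℕ) :=
  (posetP n).filter (fun p => d < p.1 ∧ p.2 ≤ d)

/-- The width of a finite subset of `ℕ × ℕ` (with the componentwise order):
the maximal cardinality of an antichain contained in it. -/
noncomputable def finWidth (Q : Finset (ℕ × ℕ)) : ℕ :=
  sSup (Finset.card '' {A : Finset (ℕ × ℕ) |
    A ⊆ Q ∧ IsAntichain (· ≤ ·) (A : Set (ℕ × ℕ))})

/-- The polytope `X_{𝐦,M} ⊆ ℝ_{≥0}^P`, realized as the set of functions `ℕ × ℕ → ℝ`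
supported on `P`, with nonnegative coordinates, satisfying for every `P' ⊆ P` the
inequality `Σ_{α ∈ P'} x_α ≤ M + Σ_{d=1}^{n-1} m_d · w(P' ∩ P_d)`. -/
def polytopeX (n : ℕ) (m : ℕ → ℕ) (M : ℕ) : Set (ℕ × ℕ → ℝ) :=
  {x | (∀ α, α ∉ posetP n → x α = 0) ∧ (∀ α, 0 ≤ x α) ∧
    ∀ P' ⊆ posetP n,
      ∑ α ∈ P', x α ≤
        (M : ℝ) + ∑ d ∈ Finset.Icc 1 (n - 1), (m d : ℝ) * (finWidth (P' ∩ posetPd n d) : ℝ)}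

lemma card_le_finWidth {A Q : Finset (ℕ × ℕ)} (hAQ : A ⊆ Q)
    (hA : IsAntichain (· ≤ ·) (A : Set (ℕ × ℕ))) : A.card ≤ finWidth Q := by
  refine le_csSup ⟨Q.card, ?_⟩ ⟨A, ⟨hAQ, hA⟩, rfl⟩
  rintro _ ⟨B, ⟨hB, -⟩, rfl⟩
  exact Finset.card_le_card hB

lemma finWidth_le {Q : Finset (ℕ × ℕ)} {k : ℕ}
    (h : ∀ A ⊆ Q, IsAntichain (· ≤ ·) (A : Set (ℕ × ℕ)) → A.card ≤ k) : finWidth Q ≤ k := by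
  refine csSup_le' ?_
  rintro _ ⟨B, ⟨hB, hB'⟩, rfl⟩
  exact h B hB hB'

/-- The elements of `P` lying strictly to the south-east of `p`, i.e. the intervals `[j, i)` that
strictly contain the interval of `p` at both ends. -/
def strictOuter (n : ℕ) (p : ℕ × ℕ) : Finset (ℕ × ℕ) :=
  (posetP n).filter (fun q => p.1 < q.1 ∧ q.2 < p.2)

/-- The maximal `c`-weight of an antichain contained in `Q`. -/
noncomputable def maxWeight (c : ℕ × ℕ → ℕ) (Q : Finset (ℕ × ℕ)) : ℕ :=
  open Classical in
  (Q.powerset.filter (fun A : Finset (ℕ × ℕ) => IsAntichain (· ≤ ·) (A : Set (ℕ × ℕ)))).sup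
    fun A => ∑ p ∈ A, c p

lemma sum_le_maxWeight (c : ℕ × ℕ → ℕ) {A Q : Finset (ℕ × ℕ)} (hAQ : A ⊆ Q)
    (hA : IsAntichain (· ≤ ·) (A : Set (ℕ × ℕ))) : ∑ p ∈ A, c p ≤ maxWeight c Q := by
  classical
  exact Finset.le_sup (f := fun A : Finset (ℕ × ℕ) => ∑ p ∈ A, c p)
    (Finset.mem_filter.2 ⟨Finset.mem_powerset.2 hAQ, hA⟩)

lemma exists_sum_eq_maxWeight (c : ℕ × ℕ → ℕ) (Q : Finset (ℕ × ℕ)) :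
    ∃ A ⊆ Q, IsAntichain (· ≤ ·) (A : Set (ℕ × ℕ)) ∧ ∑ p ∈ A, c p = maxWeight c Q := by
  classical
  obtain ⟨A, hA, h⟩ := Finset.exists_mem_eq_sup
    (Q.powerset.filter (fun A : Finset (ℕ × ℕ) => IsAntichain (· ≤ ·) (A : Set (ℕ × ℕ))))
    ⟨∅, by simp⟩ (fun A => ∑ p ∈ A, c p)
  rw [Finset.mem_filter, Finset.mem_powerset] at hA
  exact ⟨A, hA.1, hA.2, h.symm⟩

lemma exists_antichain_insert (n : ℕ) (c : ℕ × ℕ → ℕ) (p : ℕ × ℕ) :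
    ∃ A ⊆ insert p (strictOuter n p), IsAntichain (· ≤ ·) (A : Set (ℕ × ℕ)) ∧
      ∑ q ∈ A, c q = maxWeight c (strictOuter n p) + c p := by
  obtain ⟨A, hAQ, hA, hsum⟩ := exists_sum_eq_maxWeight c (strictOuter n p)
  have hout : ∀ q ∈ A, p.1 < q.1 ∧ q.2 < p.2 := fun q hq => (Finset.mem_filter.1 (hAQ hq)).2
  have hp : p ∉ A := fun h => lt_irrefl _ (hout p h).1
  refine ⟨insert p A, Finset.insert_subset_insert _ hAQ, ?_, ?_⟩
  · rw [Finset.coe_insert]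
    refine hA.insert (fun q hq _ h => ?_) (fun q hq _ h => ?_)
    · exact absurd h.1 (not_le.2 (hout q hq).1)
    · exact absurd h.2 (not_le.2 (hout q hq).2)
  · rw [Finset.sum_insert hp, hsum, add_comm]

lemma maxWeight_strictOuter_add_le {n : ℕ} (c : ℕ × ℕ → ℕ) {p q : ℕ × ℕ} (hq : q ∈ posetP n)
    (h₁ : p.1 < q.1) (h₂ : q.2 < p.2) :
    maxWeight c (strictOuter n q) + c q ≤ maxWeight c (strictOuter n p) := by
  obtain ⟨A, hAQ, hA, hsum⟩ := exists_antichain_insert n c q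
  rw [← hsum]
  refine sum_le_maxWeight c (hAQ.trans ?_) hA
  intro r hr
  rw [Finset.mem_insert] at hr
  rcases hr with rfl | hr
  · exact Finset.mem_filter.2 ⟨hq, h₁, h₂⟩
  · have hr' := Finset.mem_filter.1 hr
    exact Finset.mem_filter.2 ⟨hr'.1, h₁.trans hr'.2.1, hr'.2.2.trans h₂⟩

lemma maxWeight_strictOuter_add_le_of_mem_posetPd {n d : ℕ} (c : ℕ × ℕ → ℕ) {p : ℕ × ℕ}
    (hp : p ∈ posetPd n d) :
    maxWeight c (strictOuter n p) + c p ≤ maxWeight c (posetPd n d) := by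
  obtain ⟨A, hAQ, hA, hsum⟩ := exists_antichain_insert n c p
  rw [← hsum]
  refine sum_le_maxWeight c (hAQ.trans ?_) hA
  intro r hr
  rw [Finset.mem_insert] at hr
  rcases hr with rfl | hr
  · exact hp
  · have hr' := Finset.mem_filter.1 hr
    have hp' := Finset.mem_filter.1 hp
    exact Finset.mem_filter.2 ⟨hr'.1, by omega, by omega⟩

/-- The residues modulo `N` of the interval of length `c p` starting at the maximal weight of an
antichain strictly outside `p`. -/
noncomputable def residues (n N : ℕ) (c : ℕ × ℕ → ℕ) (p : ℕ × ℕ) : Finset ℕ :=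
  (Finset.Ico (maxWeight c (strictOuter n p)) (maxWeight c (strictOuter n p) + c p)).image (· % N)

lemma card_residues (n : ℕ) {N : ℕ} (c : ℕ × ℕ → ℕ) {p : ℕ × ℕ} (hp : c p ≤ N) :
    (residues n N c p).card = c p := by
  rw [residues, Finset.card_image_of_injOn, Nat.card_Ico, Nat.add_sub_cancel_left]
  refine (Nat.mod_injOn_Ico (maxWeight c (strictOuter n p)) N).mono ?_
  intro t ht
  simp only [Finset.coe_Ico, Set.mem_Ico] at ht ⊢
  omega

lemma residues_subset (n : ℕ) {N : ℕ} (c : ℕ × ℕ → ℕ) {p : ℕ × ℕ} (hp : c p ≤ N) :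
    residues n N c p ⊆ Finset.range N := by
  intro r hr
  obtain ⟨t, ht, rfl⟩ := Finset.mem_image.1 hr
  rw [Finset.mem_Ico] at ht
  exact Finset.mem_range.2 (Nat.mod_lt _ (by omega))

lemma finWidth_filter_residues_le (n N d r : ℕ) (c : ℕ × ℕ → ℕ) :
    finWidth ((posetP n).filter (fun p => r ∈ residues n N c p) ∩ posetPd n d) ≤
      ((Finset.range (maxWeight c (posetPd n d))).filter (fun t => t % N = r)).card := by
  refine finWidth_le fun A hAQ hA => ?_
  have hex : ∀ p ∈ A, ∃ t, maxWeight c (strictOuter n p) ≤ t ∧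
      t < maxWeight c (strictOuter n p) + c p ∧ t % N = r := by
    intro p hp
    obtain ⟨t, ht, htr⟩ := Finset.mem_image.1
      (Finset.mem_filter.1 (Finset.mem_inter.1 (hAQ hp)).1).2
    rw [Finset.mem_Ico] at ht
    exact ⟨t, ht.1, ht.2, htr⟩
  choose! t ht₁ ht₂ ht₃ using hex
  have hP : ∀ p ∈ A, p ∈ posetP n := fun p hp =>
    (Finset.mem_filter.1 (Finset.mem_inter.1 (hAQ hp)).1).1
  have hlt : ∀ p ∈ A, ∀ q ∈ A, p.1 < q.1 → q.2 < p.2 → t q < t p := by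
    intro p hp q hq h₁ h₂
    have := maxWeight_strictOuter_add_le c (hP q hq) h₁ h₂
    have := ht₁ p hp
    have := ht₂ q hq
    omega
  refine Finset.card_le_card_of_injOn t (fun p hp => ?_) (fun p hp q hq hpq => ?_)
  · refine Finset.mem_coe.2 (Finset.mem_filter.2 ⟨Finset.mem_range.2 ?_, ht₃ p hp⟩)
    exact (ht₂ p hp).trans_le
      (maxWeight_strictOuter_add_le_of_mem_posetPd c (Finset.mem_inter.1 (hAQ hp)).2)
  · by_contra hne
    have h₁ : ¬ p ≤ q := hA hp hq hne
    have h₂ : ¬ q ≤ p := hA hq hp (Ne.symm hne)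
    rw [Prod.le_def] at h₁ h₂
    rcases lt_or_ge p.1 q.1 with h | h
    · exact (hlt p hp q hq h (by omega)).ne' hpq
    · exact (hlt q hq p hp (by omega) (by omega)).ne hpq

lemma sum_finWidth_filter_residues_le (n N d : ℕ) (c : ℕ × ℕ → ℕ) :
    ∑ r ∈ Finset.range N,
      finWidth ((posetP n).filter (fun p => r ∈ residues n N c p) ∩ posetPd n d) ≤
        maxWeight c (posetPd n d) := by
  rcases Nat.eq_zero_or_pos N with rfl | hN
  · simp
  calc _ ≤ ∑ r ∈ Finset.range N,
        ((Finset.range (maxWeight c (posetPd n d))).filter (fun t => t % N = r)).card :=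
        Finset.sum_le_sum fun r _ => finWidth_filter_residues_le n N d r c
    _ = (Finset.range (maxWeight c (posetPd n d))).card :=
        (Finset.card_eq_sum_card_fiberwise fun t _ =>
          Finset.mem_coe.2 (Finset.mem_range.2 (Nat.mod_lt t hN))).symm
    _ = _ := Finset.card_range _

lemma sum_natWeight_mul_le {n M N : ℕ} {m : ℕ → ℕ} {x : ℕ × ℕ → ℝ} (hx : x ∈ polytopeX n m M)
    (c : ℕ × ℕ → ℕ) (hc : ∀ p ∈ posetP n, c p ≤ N) :
    ∑ p ∈ posetP n, (c p : ℝ) * x p ≤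
      (M : ℝ) * N + ∑ d ∈ Finset.Icc 1 (n - 1), (m d : ℝ) * (maxWeight c (posetPd n d) : ℝ) := by
  obtain ⟨-, -, hineq⟩ := hx
  calc ∑ p ∈ posetP n, (c p : ℝ) * x p
      = ∑ p ∈ posetP n, ∑ r ∈ Finset.range N, if r ∈ residues n N c p then x p else 0 := by
        refine Finset.sum_congr rfl fun p hp => ?_
        rw [← Finset.sum_filter, Finset.filter_mem_eq_inter,
          Finset.inter_eq_right.2 (residues_subset n c (hc p hp)), Finset.sum_const,
          card_residues n c (hc p hp), nsmul_eq_mul]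
    _ = ∑ r ∈ Finset.range N, ∑ p ∈ (posetP n).filter (fun p => r ∈ residues n N c p), x p := by
        rw [Finset.sum_comm]
        simp only [Finset.sum_filter]
    _ ≤ ∑ r ∈ Finset.range N, ((M : ℝ) + ∑ d ∈ Finset.Icc 1 (n - 1), (m d : ℝ) *
          (finWidth ((posetP n).filter (fun p => r ∈ residues n N c p) ∩ posetPd n d) : ℝ)) :=
        Finset.sum_le_sum fun r _ => hineq _ (Finset.filter_subset _ _)
    _ = (M : ℝ) * N + ∑ d ∈ Finset.Icc 1 (n - 1), (m d : ℝ) * ((∑ r ∈ Finset.range N,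
          finWidth ((posetP n).filter (fun p => r ∈ residues n N c p) ∩ posetPd n d) : ℕ) : ℝ) := by
        rw [Finset.sum_add_distrib, Finset.sum_const, Finset.card_range, nsmul_eq_mul,
          mul_comm (N : ℝ), Finset.sum_comm]
        simp only [Nat.cast_sum, Finset.mul_sum]
    _ ≤ _ := by
        gcongr with d
        exact sum_finWidth_filter_residues_le n N d c

lemma sum_weight_mul_le {n M : ℕ} {m : ℕ → ℕ} {x : ℕ × ℕ → ℝ} (hx : x ∈ polytopeX n m M)
    (c : ℕ × ℕ → ℝ) (hc₀ : ∀ p, 0 ≤ c p) {g : ℝ} (hg : ∀ p ∈ posetP n, c p ≤ g) (hg₀ : 0 ≤ g)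
    {h : ℕ → ℝ} (hh : ∀ d, ∀ A ⊆ posetPd n d, IsAntichain (· ≤ ·) (A : Set (ℕ × ℕ)) →
      ∑ p ∈ A, c p ≤ h d) :
    ∑ p ∈ posetP n, c p * x p ≤ (M : ℝ) * g + ∑ d ∈ Finset.Icc 1 (n - 1), (m d : ℝ) * h d := by
  have key : ∀ k : ℕ, (k : ℝ) * ∑ p ∈ posetP n, c p * x p ≤
      k * ((M : ℝ) * g + ∑ d ∈ Finset.Icc 1 (n - 1), (m d : ℝ) * h d) + ∑ p ∈ posetP n, x p := by
    intro k
    have hk : (0 : ℝ) ≤ k := k.cast_nonneg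
    have hfloor : ∀ p, (⌊k * c p⌋₊ : ℝ) ≤ k * c p := fun p =>
      Nat.floor_le (mul_nonneg hk (hc₀ p))
    have hnat := sum_natWeight_mul_le hx (N := ⌊k * g⌋₊) (fun p => ⌊k * c p⌋₊)
      (fun p hp => Nat.floor_le_floor (mul_le_mul_of_nonneg_left (hg p hp) hk))
    have hmax : ∀ d, (maxWeight (fun p => ⌊k * c p⌋₊) (posetPd n d) : ℝ) ≤ k * h d := by
      intro d
      obtain ⟨A, hAQ, hA, hsum⟩ := exists_sum_eq_maxWeight (fun p => ⌊k * c p⌋₊) (posetPd n d)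
      rw [← hsum, Nat.cast_sum]
      calc ∑ p ∈ A, (⌊k * c p⌋₊ : ℝ) ≤ ∑ p ∈ A, k * c p := Finset.sum_le_sum fun p _ => hfloor p
        _ = k * ∑ p ∈ A, c p := (Finset.mul_sum _ _ _).symm
        _ ≤ k * h d := mul_le_mul_of_nonneg_left (hh d A hAQ hA) hk
    calc (k : ℝ) * ∑ p ∈ posetP n, c p * x p
        ≤ ∑ p ∈ posetP n, ((⌊k * c p⌋₊ : ℝ) * x p + x p) := by
          rw [Finset.mul_sum]
          refine Finset.sum_le_sum fun p _ => ?_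
          have := mul_le_mul_of_nonneg_right (Nat.lt_floor_add_one (k * c p)).le (hx.2.1 p)
          linarith
      _ = ∑ p ∈ posetP n, (⌊k * c p⌋₊ : ℝ) * x p + ∑ p ∈ posetP n, x p := Finset.sum_add_distrib
      _ ≤ ((M : ℝ) * (k * g) + ∑ d ∈ Finset.Icc 1 (n - 1), (m d : ℝ) * (k * h d)) +
            ∑ p ∈ posetP n, x p := by
          refine add_le_add (hnat.trans ?_) le_rfl
          gcongr with d
          · exact Nat.floor_le (mul_nonneg hk hg₀)
          · exact hmax d
      _ = _ := by
          rw [mul_add, Finset.mul_sum]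
          congr 2
          · ring
          · exact Finset.sum_congr rfl fun d _ => by ring
  by_contra! hlt
  obtain ⟨k, hk⟩ := exists_nat_gt ((∑ p ∈ posetP n, x p) /
    (∑ p ∈ posetP n, c p * x p -
      ((M : ℝ) * g + ∑ d ∈ Finset.Icc 1 (n - 1), (m d : ℝ) * h d)))
  rw [div_lt_iff₀ (sub_pos.2 hlt)] at hk
  linarith [key k]

lemma convex_polytopeX (n : ℕ) (m : ℕ → ℕ) (M : ℕ) : Convex ℝ (polytopeX n m M) := by
  rintro x ⟨hx₀, hx₁, hx₂⟩ y ⟨hy₀, hy₁, hy₂⟩ a b ha hb hab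
  refine ⟨fun p hp => ?_, fun p => ?_, fun Q hQ => ?_⟩
  · simp [hx₀ p hp, hy₀ p hp]
  · exact add_nonneg (mul_nonneg ha (hx₁ p)) (mul_nonneg hb (hy₁ p))
  · simp only [Pi.add_apply, Pi.smul_apply, smul_eq_mul, Finset.sum_add_distrib, ← Finset.mul_sum]
    exact convex_Iic _ (Set.mem_Iic.2 (hx₂ Q hQ)) (Set.mem_Iic.2 (hy₂ Q hQ)) ha hb hab

lemma isCompact_polytopeX (n : ℕ) (m : ℕ → ℕ) (M : ℕ) : IsCompact (polytopeX n m M) := by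
  have hclosed : IsClosed (polytopeX n m M) := by
    simp only [polytopeX, Set.ofPred_and, Set.ofPred_forall]
    refine IsClosed.inter ?_ (IsClosed.inter ?_ ?_)
    · exact isClosed_iInter fun p => isClosed_iInter fun _ =>
        isClosed_eq (continuous_apply p) continuous_const
    · exact isClosed_iInter fun p => isClosed_le continuous_const (continuous_apply p)
    · exact isClosed_iInter fun Q => isClosed_iInter fun _ =>
        isClosed_le (continuous_finsetSum _ fun p _ => continuous_apply p) continuous_const
  set B : ℝ := (M : ℝ) + ∑ d ∈ Finset.Icc 1 (n - 1),
    (m d : ℝ) * (finWidth (posetP n ∩ posetPd n d) : ℝ)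
  refine (isCompact_univ_pi fun _ : ℕ × ℕ =>
    isCompact_Icc (a := (0 : ℝ)) (b := B)).of_isClosed_subset hclosed ?_
  rintro x ⟨hx₀, hx₁, hx₂⟩ p -
  refine ⟨hx₁ p, ?_⟩
  by_cases hp : p ∈ posetP n
  · exact (Finset.single_le_sum (fun q _ => hx₁ q) hp).trans (hx₂ _ subset_rfl)
  · rw [hx₀ p hp]
    positivity

/-- The point `M e + Σ_d m_d 1_{A_d}`, where `e` is the indicator of `E`. -/
noncomputable def vertexPoint (n : ℕ) (m : ℕ → ℕ) (M : ℕ) (E : Finset (ℕ × ℕ))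
    (A : ℕ → Finset (ℕ × ℕ)) : ℕ × ℕ → ℝ := fun p =>
  (M : ℝ) * (if p ∈ E then 1 else 0) +
    ∑ d ∈ Finset.Icc 1 (n - 1), (m d : ℝ) * (if p ∈ A d then 1 else 0)

lemma sum_mul_vertexPoint {n M : ℕ} {m : ℕ → ℕ} {E : Finset (ℕ × ℕ)}
    {A : ℕ → Finset (ℕ × ℕ)} (c : ℕ × ℕ → ℝ) (Q : Finset (ℕ × ℕ)) :
    ∑ p ∈ Q, c p * vertexPoint n m M E A p =
      (M : ℝ) * ∑ p ∈ Q ∩ E, c p +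
        ∑ d ∈ Finset.Icc 1 (n - 1), (m d : ℝ) * ∑ p ∈ Q ∩ A d, c p := by
  simp only [vertexPoint, mul_add, Finset.sum_add_distrib, Finset.mul_sum,
    ← Finset.filter_mem_eq_inter, Finset.sum_filter]
  rw [Finset.sum_comm]
  congr 1
  · exact Finset.sum_congr rfl fun p _ => by split_ifs <;> ring
  · refine Finset.sum_congr rfl fun d _ => Finset.sum_congr rfl fun p _ => ?_
    split_ifs <;> ring

lemma vertexPoint_mem_polytopeX {n : ℕ} (m : ℕ → ℕ) (M : ℕ) {E : Finset (ℕ × ℕ)}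
    (hE : E ⊆ posetP n) (hE₁ : E.card ≤ 1) {A : ℕ → Finset (ℕ × ℕ)}
    (hA : ∀ d, A d ⊆ posetPd n d) (hA' : ∀ d, IsAntichain (· ≤ ·) (A d : Set (ℕ × ℕ))) :
    vertexPoint n m M E A ∈ polytopeX n m M := by
  refine ⟨fun p hp => ?_, fun p => ?_, fun Q _ => ?_⟩
  · have h₁ : p ∉ E := fun h => hp (hE h)
    have h₂ : ∀ d, p ∉ A d := fun d h => hp (Finset.mem_filter.1 (hA d h)).1
    simp [vertexPoint, h₁, h₂]
  · unfold vertexPoint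
    positivity
  · have h := sum_mul_vertexPoint (n := n) (M := M) (m := m) (E := E) (A := A) (fun _ => 1) Q
    simp only [one_mul, Finset.sum_const, nsmul_eq_mul, mul_one] at h
    rw [h]
    have hcard : (Q ∩ E).card ≤ 1 := (Finset.card_le_card Finset.inter_subset_right).trans hE₁
    refine add_le_add (mul_le_of_le_one_right (by positivity) (mod_cast hcard)) ?_
    gcongr with d
    refine card_le_finWidth (Finset.inter_subset_inter_left (hA d)) ((hA' d).subset ?_)
    exact_mod_cast Finset.inter_subset_right

lemma exists_antichain_forall_sum_posPart_le (c : ℕ × ℕ → ℝ) (Q : Finset (ℕ × ℕ)) :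
    ∃ A ⊆ Q, IsAntichain (· ≤ ·) (A : Set (ℕ × ℕ)) ∧
      ∀ B ⊆ Q, IsAntichain (· ≤ ·) (B : Set (ℕ × ℕ)) →
        ∑ p ∈ B, max (c p) 0 ≤ ∑ p ∈ A, c p := by
  classical
  obtain ⟨A, hA, hmax⟩ := Finset.exists_max_image
    (Q.powerset.filter (fun A : Finset (ℕ × ℕ) => IsAntichain (· ≤ ·) (A : Set (ℕ × ℕ))))
    (fun A => ∑ p ∈ A, c p) ⟨∅, by simp⟩
  rw [Finset.mem_filter, Finset.mem_powerset] at hA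
  refine ⟨A, hA.1, hA.2, fun B hBQ hB => ?_⟩
  have hpos : ∑ p ∈ B, max (c p) 0 = ∑ p ∈ B.filter (fun p => 0 ≤ c p), c p := by
    rw [Finset.sum_filter]
    refine Finset.sum_congr rfl fun p _ => ?_
    split_ifs with h
    · exact max_eq_left h
    · exact max_eq_right (not_le.1 h).le
  rw [hpos]
  refine hmax _ (Finset.mem_filter.2 ⟨Finset.mem_powerset.2 ?_, hB.subset ?_⟩)
  · exact (Finset.filter_subset _ _).trans hBQ
  · exact_mod_cast Finset.filter_subset _ _

lemma exists_card_le_one_forall_posPart_le (c : ℕ × ℕ → ℝ) (Q : Finset (ℕ × ℕ)) :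
    ∃ E ⊆ Q, E.card ≤ 1 ∧ 0 ≤ ∑ p ∈ E, c p ∧ ∀ p ∈ Q, max (c p) 0 ≤ ∑ p ∈ E, c p := by
  classical
  obtain ⟨E, hE, hmax⟩ := Finset.exists_max_image
    (Q.powerset.filter (fun E => E.card ≤ 1)) (fun E => ∑ p ∈ E, c p) ⟨∅, by simp⟩
  rw [Finset.mem_filter, Finset.mem_powerset] at hE
  have h₀ : 0 ≤ ∑ p ∈ E, c p := by simpa using hmax ∅ (by simp)
  refine ⟨E, hE.1, hE.2, h₀, fun p hp => max_le ?_ h₀⟩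
  simpa using hmax {p} (by simpa using hp)

lemma map_eq_sum_of_support (f : (ℕ × ℕ → ℝ) →L[ℝ] ℝ) {Q : Finset (ℕ × ℕ)} {x : ℕ × ℕ → ℝ}
    (hx : ∀ p, p ∉ Q → x p = 0) : f x = ∑ p ∈ Q, f (Pi.single p 1) * x p := by
  have h : x = ∑ p ∈ Q, x p • (Pi.single p 1 : ℕ × ℕ → ℝ) := by
    funext q
    simp only [Finset.sum_apply, Pi.smul_apply, smul_eq_mul, Pi.single_apply, mul_ite, mul_one,
      mul_zero, Finset.sum_ite_eq]
    split_ifs with hq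
    · rfl
    · exact hx q hq
  conv_lhs => rw [h]
  simp [map_sum, mul_comm]

lemma polytopeX_add_subset (n : ℕ) (m m' : ℕ → ℕ) (M M' : ℕ) :
    polytopeX n m M + polytopeX n m' M' ⊆ polytopeX n (fun d => m d + m' d) (M + M') := by
  rintro _ ⟨x, ⟨hx₀, hx₁, hx₂⟩, y, ⟨hy₀, hy₁, hy₂⟩, rfl⟩
  refine ⟨fun p hp => ?_, fun p => add_nonneg (hx₁ p) (hy₁ p), fun Q hQ => ?_⟩
  · simp [hx₀ p hp, hy₀ p hp]
  · have := add_le_add (hx₂ Q hQ) (hy₂ Q hQ)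
    simp only [Pi.add_apply, Nat.cast_add, add_mul, Finset.sum_add_distrib]
    linarith

lemma subset_polytopeX_add (n : ℕ) (m m' : ℕ → ℕ) (M M' : ℕ) :
    polytopeX n (fun d => m d + m' d) (M + M') ⊆ polytopeX n m M + polytopeX n m' M' := by
  intro x hx
  by_contra hx'
  obtain ⟨f, u, hfu, hux⟩ := geometric_hahn_banach_closed_point
    ((convex_polytopeX n m M).add (convex_polytopeX n m' M'))
    ((isCompact_polytopeX n m M).add (isCompact_polytopeX n m' M')).isClosed hx'
  set c : ℕ × ℕ → ℝ := fun p => f (Pi.single p 1)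
  choose A hAQ hA hAmax using fun d => exists_antichain_forall_sum_posPart_le c (posetPd n d)
  obtain ⟨E, hEQ, hE₁, hE₀, hEmax⟩ := exists_card_le_one_forall_posPart_le c (posetP n)
  have hvertex : ∀ (k : ℕ → ℕ) (K : ℕ), f (vertexPoint n k K E A) = (K : ℝ) * ∑ p ∈ E, c p +
      ∑ d ∈ Finset.Icc 1 (n - 1), (k d : ℝ) * ∑ p ∈ A d, c p := by
    intro k K
    rw [map_eq_sum_of_support f (vertexPoint_mem_polytopeX k K hEQ hE₁ hAQ hA).1,
      sum_mul_vertexPoint, Finset.inter_eq_right.2 hEQ]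
    congr 1
    refine Finset.sum_congr rfl fun d _ => ?_
    rw [Finset.inter_eq_right.2 ((hAQ d).trans (Finset.filter_subset _ _))]
  have hlt := hfu _ (Set.add_mem_add (vertexPoint_mem_polytopeX m M hEQ hE₁ hAQ hA)
    (vertexPoint_mem_polytopeX m' M' hEQ hE₁ hAQ hA))
  rw [map_add, hvertex, hvertex] at hlt
  have hle : f x ≤ ∑ p ∈ posetP n, max (c p) 0 * x p := by
    rw [map_eq_sum_of_support f hx.1]
    exact Finset.sum_le_sum fun p _ => mul_le_mul_of_nonneg_right (le_max_left _ _) (hx.2.1 p)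
  have hbound := sum_weight_mul_le hx (fun p => max (c p) 0) (fun p => le_max_right _ _)
    hEmax hE₀ hAmax
  simp only [Nat.cast_add, add_mul, Finset.sum_add_distrib] at hbound
  linarith

/-- Minkowski sum property for the polytopes:
`X_{𝐦,M} + X_{𝐦',M'} = X_{𝐦+𝐦',M+M'}`. -/
theorem statement3 (n : ℕ) (hn : 2 ≤ n) (m m' : ℕ → ℕ) (M M' : ℕ) :
    polytopeX n m M + polytopeX n m' M' = polytopeX n (fun d => m d + m' d) (M + M') :=
  (polytopeX_add_subset n m m' M M').antisymm (subset_polytopeX_add n m m' M M')
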